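/- Let n ≥ 1, 2 ≤ p < ∞, and k = [n/2]+1, and let q be the conjugate exponent, 1/p + 1/q = 1. Let a : 𝕋ⁿ × ℤⁿ → ℂ be a symbol, smooth in x, such that there is C_k > 0 with |∂_x^β a(x,ξ)| ≤ C_k for all (x,ξ) ∈ 𝕋ⁿ × ℤⁿ and all multi-indices β with |β| ≤ k. Then a(x,D) : L^p(𝕋ⁿ) → L^q(𝕋ⁿ) is a bounded operator, i.e. there is C > 0 with ‖a(x,D)f‖_{L^q(𝕋ⁿ)} ≤ C ‖f‖_{L^p(𝕋ⁿ)} for all smooth f. -/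

import Mathlib

open MeasureTheory Real ENNReal

noncomputable section

/-- Partial derivative of a complex-valued function on `ℝⁿ` in the `j`-th coordinate
direction. -/
def pd {n : ℕ} (j : Fin n) (f : (Fin n → ℝ) → ℂ) : (Fin n → ℝ) → ℂ :=
  fun x => fderiv ℝ f x (Pi.single j 1)

/-- The canonical list of directions associated to a multi-index `β ∈ ℕⁿ`. -/
def mIdxList {n : ℕ} (β : Fin n → ℕ) : List (Fin n) :=
  (List.finRange n).flatMap fun j => List.replicate (β j) j

/-- Iterated partial derivative `∂^β` associated to a multi-index `β`. -/
def pdM {n : ℕ} (β : Fin n → ℕ) (f : (Fin n → ℝ) → ℂ) : (Fin n → ℝ) → ℂ :=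
  (mIdxList β).foldr pd f

/-- Forward difference operator in the `j`-th direction on functions of `ξ ∈ ℤⁿ`. -/
def dd {n : ℕ} (j : Fin n) (g : (Fin n → ℤ) → ℂ) : (Fin n → ℤ) → ℂ :=
  fun ξ => g (ξ + Pi.single j 1) - g ξ

/-- Iterated difference operator `Δ_ξ^α` associated to a multi-index `α`. -/
def ddM {n : ℕ} (α : Fin n → ℕ) (g : (Fin n → ℤ) → ℂ) : (Fin n → ℤ) → ℂ :=
  (mIdxList α).foldr dd g

/-- Japanese bracket `⟨ξ⟩ = (1+|ξ|²)^{1/2}` of a lattice point `ξ ∈ ℤⁿ`. -/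
def jb {n : ℕ} (ξ : Fin n → ℤ) : ℝ := Real.sqrt (1 + ∑ j, ((ξ j : ℝ)) ^ 2)

/-- Japanese bracket `⟨ξ⟩ = (1+|ξ|²)^{1/2}` of a vector `ξ ∈ ℝⁿ`. -/
def jbR {n : ℕ} (ξ : Fin n → ℝ) : ℝ := Real.sqrt (1 + ∑ j, (ξ j) ^ 2)

/-- The canonical embedding `ℤⁿ → ℝⁿ`. -/
def castZ {n : ℕ} (ξ : Fin n → ℤ) : Fin n → ℝ := fun j => (ξ j : ℝ)

/-- The fundamental domain `[0,1)ⁿ` of the torus `𝕋ⁿ = ℝⁿ/ℤⁿ`. -/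
def cube (n : ℕ) : Set (Fin n → ℝ) := Set.univ.pi fun _ => Set.Ico (0 : ℝ) 1

/-- The normalized Lebesgue measure of the torus `𝕋ⁿ`, realized as the Lebesgue measure
on `ℝⁿ` restricted to the fundamental domain `[0,1)ⁿ`. -/
def μT (n : ℕ) : Measure (Fin n → ℝ) := volume.restrict (cube n)

/-- `1`-periodicity of a function on `ℝⁿ` (i.e. the function descends to `𝕋ⁿ`). -/
def Per {n : ℕ} (f : (Fin n → ℝ) → ℂ) : Prop :=
  ∀ (x : Fin n → ℝ) (v : Fin n → ℤ), f (x + fun j => (v j : ℝ)) = f x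

/-- The character `e^{2πi⟨x,ξ⟩}`. -/
def eChar {n : ℕ} (x : Fin n → ℝ) (ξ : Fin n → ℤ) : ℂ :=
  Complex.exp (2 * (π : ℂ) * Complex.I * ∑ j, (x j : ℂ) * (ξ j : ℂ))

/-- Fourier coefficient `f̂(ξ) = ∫_{𝕋ⁿ} e^{-2πi⟨x,ξ⟩} f(x) dx` of a function on `𝕋ⁿ`. -/
def fc {n : ℕ} (f : (Fin n → ℝ) → ℂ) (ξ : Fin n → ℤ) : ℂ :=
  ∫ x, Complex.exp (-(2 * (π : ℂ) * Complex.I) * ∑ j, (x j : ℂ) * (ξ j : ℂ)) * f x ∂(μT n)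

/-- Periodic pseudo-differential operator
    `σ(x,D)f(x) = Σ_{ξ ∈ ℤⁿ} e^{2πi⟨x,ξ⟩} σ(x,ξ) f̂(ξ)`
with symbol `σ` on `𝕋ⁿ × ℤⁿ`. -/
def Op {n : ℕ} (σ : (Fin n → ℝ) → (Fin n → ℤ) → ℂ) (f : (Fin n → ℝ) → ℂ) :
    (Fin n → ℝ) → ℂ :=
  fun x => ∑' ξ : Fin n → ℤ, eChar x ξ * σ x ξ * fc f ξ

/-- The `L^p(𝕋ⁿ)` norm, for a real exponent `p`. -/
def lpT (n : ℕ) (p : ℝ) (g : (Fin n → ℝ) → ℂ) : ℝ :=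
  (∫ x, ‖g x‖ ^ p ∂(μT n)) ^ (1 / p)

/-- `∂_x^β Δ_ξ^α σ(x,ξ)` for a symbol `σ` on `𝕋ⁿ × ℤⁿ` (difference operator applied first,
then the derivatives in `x`). -/
def symbDxD {n : ℕ} (β α : Fin n → ℕ) (σ : (Fin n → ℝ) → (Fin n → ℤ) → ℂ)
    (x : Fin n → ℝ) (ξ : Fin n → ℤ) : ℂ :=
  pdM β (fun x' => ddM α (σ x') ξ) x

/-- `Δ_ξ^α ∂_x^β σ(x,ξ)` for a symbol `σ` on `𝕋ⁿ × ℤⁿ` (derivatives in `x` applied first,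
then the difference operator in `ξ`). -/
def symbDDx {n : ℕ} (α β : Fin n → ℕ) (σ : (Fin n → ℝ) → (Fin n → ℤ) → ℂ)
    (x : Fin n → ℝ) (ξ : Fin n → ℤ) : ℂ :=
  ddM α (fun ξ' => pdM β (fun x' => σ x' ξ') x) ξ

/-- `∂_ξ^α ∂_x^β σ(x,ξ)` for a symbol `σ` on `𝕋ⁿ × ℝⁿ` (derivatives in `x` applied first,
then the derivatives in `ξ`). -/
def symbDξDx {n : ℕ} (α β : Fin n → ℕ) (σ : (Fin n → ℝ) → (Fin n → ℝ) → ℂ)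
    (x ξ : Fin n → ℝ) : ℂ :=
  pdM α (fun ξ' => pdM β (fun x' => σ x' ξ') x) ξ

/-- `∂_x^β ∂_ξ^α σ(x,ξ)` for a symbol `σ` on `𝕋ⁿ × ℝⁿ` (derivatives in `ξ` applied first,
then the derivatives in `x`). -/
def symbDxDξ {n : ℕ} (β α : Fin n → ℕ) (σ : (Fin n → ℝ) → (Fin n → ℝ) → ℂ)
    (x ξ : Fin n → ℝ) : ℂ :=
  pdM β (fun x' => pdM α (σ x') ξ) x

/-- The Euclidean Fourier transform `û(ξ) = ∫_{ℝⁿ} e^{-2πi⟨x,ξ⟩} u(x) dx`. -/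
def FT {n : ℕ} (u : (Fin n → ℝ) → ℂ) (ξ : Fin n → ℝ) : ℂ :=
  ∫ x, Complex.exp (-(2 * (π : ℂ) * Complex.I) * ∑ j, (x j : ℂ) * (ξ j : ℂ)) * u x

/-- Pseudo-differential operator on `ℝⁿ`:
`T_σ u(x) = ∫_{ℝⁿ} e^{2πi⟨x,ξ⟩} σ(x,ξ) û(ξ) dξ`. -/
def OpR {n : ℕ} (σ : (Fin n → ℝ) → (Fin n → ℝ) → ℂ) (u : (Fin n → ℝ) → ℂ) :
    (Fin n → ℝ) → ℂ :=
  fun x => ∫ ξ, Complex.exp (2 * (π : ℂ) * Complex.I * ∑ j, (x j : ℂ) * (ξ j : ℂ)) * σ x ξ * FT u ξ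

/-- Periodic amplitude operator
`a(x,y,D)u(x) = ∫_{𝕋ⁿ} ∫_{ℝⁿ} e^{2πi⟨x-y,ξ⟩} a(x,y,ξ) u(y) dξ dy`. -/
def OpAmp {n : ℕ} (a : (Fin n → ℝ) → (Fin n → ℝ) → (Fin n → ℝ) → ℂ)
    (u : (Fin n → ℝ) → ℂ) : (Fin n → ℝ) → ℂ :=
  fun x => ∫ y,
    (∫ ξ, Complex.exp (2 * (π : ℂ) * Complex.I * ∑ j, ((x j : ℂ) - (y j : ℂ)) * (ξ j : ℂ)) *
        a x y ξ) * u y ∂(μT n)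

/-- The `L^p(ℝⁿ)` norm, for a real exponent `p`. -/
def lpR (n : ℕ) (p : ℝ) (g : (Fin n → ℝ) → ℂ) : ℝ :=
  (∫ x, ‖g x‖ ^ p) ^ (1 / p)


section TorusBridge

open Set Topology

attribute [local instance] instMeasureSpaceUnitAddCircle
attribute [local instance] instIsAddHaarMeasureUnitAddCircleVolume
attribute [local instance] instIsProbabilityMeasureUnitAddCircleVolume

instance isProbabilityMeasure_μT (n : ℕ) : IsProbabilityMeasure (μT n) := by
  refine ⟨?_⟩
  rw [μT, Measure.restrict_apply_univ, cube, Real.volume_pi_Ico]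
  simp

theorem cube_ae_eq_Icc (n : ℕ) :
    cube n =ᵐ[volume] (Icc 0 1 : Set (Fin n → ℝ)) :=
  Measure.univ_pi_Ico_ae_eq_Icc (f := fun _ => 0) (g := fun _ => 1)

theorem μT_eq_restrict_Icc (n : ℕ) :
    μT n = volume.restrict (Icc 0 1 : Set (Fin n → ℝ)) :=
  Measure.restrict_congr_set (cube_ae_eq_Icc n)

/-- The quotient map `ℝⁿ → ℝⁿ/ℤⁿ`. -/
def toTorus {n : ℕ} (x : Fin n → ℝ) : UnitAddTorus (Fin n) := fun i => (x i : UnitAddCircle)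

theorem isOpenQuotientMap_toTorus (n : ℕ) : IsOpenQuotientMap (toTorus (n := n)) :=
  IsOpenQuotientMap.piMap fun _ => QuotientAddGroup.isOpenQuotientMap_mk

theorem integral_toTorus {n : ℕ} {E : Type*} [NormedAddCommGroup E] [NormedSpace ℝ E]
    (G : UnitAddTorus (Fin n) → E) : ∫ x, G (toTorus x) ∂(μT n) = ∫ t, G t := by
  have h : {x : Fin n → ℝ | ∀ i, x i ∈ Ioc ((0 : Fin n → ℝ) i) ((0 : Fin n → ℝ) i + 1)}
      =ᵐ[volume] cube n := by
    refine Filter.EventuallyEq.trans ?_ (cube_ae_eq_Icc n).symm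
    have := Measure.univ_pi_Ioc_ae_eq_Icc (μ := fun _ : Fin n => (volume : Measure ℝ))
      (f := fun _ => 0) (g := fun _ => 1)
    have hset : {x : Fin n → ℝ | ∀ i, x i ∈ Ioc ((0 : Fin n → ℝ) i) ((0 : Fin n → ℝ) i + 1)} =
        Set.univ.pi fun _ => Ioc (0 : ℝ) 1 := by
      ext x
      simp
    rw [hset]
    exact this
  rw [UnitAddTorus.integral_preimage G 0, setIntegral_congr_set h]
  rfl

theorem mFourier_toTorus {n : ℕ} (ξ : Fin n → ℤ) (x : Fin n → ℝ) :
    UnitAddTorus.mFourier ξ (toTorus x) = eChar x ξ := by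
  simp only [UnitAddTorus.mFourier, toTorus, ContinuousMap.coe_mk, fourier_coe_apply, eChar,
    Finset.mul_sum, Complex.exp_sum]
  refine Finset.prod_congr rfl fun i _ => ?_
  congr 1
  push_cast
  ring

theorem eChar_neg {n : ℕ} (ξ : Fin n → ℤ) (x : Fin n → ℝ) :
    eChar x (-ξ) = Complex.exp (-(2 * (π : ℂ) * Complex.I) * ∑ j, (x j : ℂ) * (ξ j : ℂ)) := by
  rw [eChar]
  congr 1
  simp

theorem fc_eq_integral_eChar {n : ℕ} (g : (Fin n → ℝ) → ℂ) (ξ : Fin n → ℤ) :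
    fc g ξ = ∫ x, eChar x (-ξ) * g x ∂(μT n) := by
  simp only [fc, eChar_neg]

theorem norm_eChar {n : ℕ} (ξ : Fin n → ℤ) (x : Fin n → ℝ) : ‖eChar x ξ‖ = 1 := by
  rw [eChar, show 2 * (π : ℂ) * Complex.I * ∑ j, (x j : ℂ) * (ξ j : ℂ)
    = ((2 * π * ∑ j, x j * ξ j : ℝ) : ℂ) * Complex.I by push_cast; ring]
  exact Complex.norm_exp_ofReal_mul_I _

theorem eChar_add {n : ℕ} (x : Fin n → ℝ) (ξ η : Fin n → ℤ) :
    eChar x (ξ + η) = eChar x ξ * eChar x η := by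
  simp only [← mFourier_toTorus, UnitAddTorus.mFourier_add]

/-- A continuous periodic function descends to the torus. -/
theorem exists_continuousMap_torus {n : ℕ} {g : (Fin n → ℝ) → ℂ} (hg : Continuous g)
    (hper : Per g) : ∃ G : C(UnitAddTorus (Fin n), ℂ), ∀ x, G (toTorus x) = g x := by
  have hq : IsQuotientMap (⟨toTorus, (isOpenQuotientMap_toTorus n).continuous⟩ :
      C(Fin n → ℝ, UnitAddTorus (Fin n))) := (isOpenQuotientMap_toTorus n).isQuotientMap
  have hfac : Function.FactorsThrough (⟨g, hg⟩ : C(Fin n → ℝ, ℂ))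
      (⟨toTorus, (isOpenQuotientMap_toTorus n).continuous⟩ :
        C(Fin n → ℝ, UnitAddTorus (Fin n))) := by
    intro x y hxy
    have : ∀ i, ∃ m : ℤ, x i + m = y i := by
      intro i
      have h1 : (x i : UnitAddCircle) = (y i : UnitAddCircle) := congrFun hxy i
      have h2 : ((y i - x i : ℝ) : UnitAddCircle) = 0 := by
        rw [AddCircle.coe_sub, h1, sub_self]
      obtain ⟨m, hm⟩ := (AddCircle.coe_eq_zero_iff 1).1 h2
      refine ⟨m, ?_⟩
      rw [zsmul_one] at hm
      linarith
    choose v hv using this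
    have := hper x v
    simp only [ContinuousMap.coe_mk]
    rw [← this]
    congr 1
    ext i
    exact hv i
  exact ⟨hq.lift ⟨g, hg⟩ hfac, fun x => DFunLike.congr_fun (hq.lift_comp ⟨g, hg⟩ hfac) x⟩

theorem fc_eq_mFourierCoeff {n : ℕ} {g : (Fin n → ℝ) → ℂ} {G : C(UnitAddTorus (Fin n), ℂ)}
    (hG : ∀ x, G (toTorus x) = g x) (ξ : Fin n → ℤ) :
    fc g ξ = UnitAddTorus.mFourierCoeff G ξ := by
  rw [fc_eq_integral_eChar, UnitAddTorus.mFourierCoeff, ← integral_toTorus]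
  simp only [mFourier_toTorus, hG, smul_eq_mul]

/-- **Parseval's identity** for continuous periodic functions. -/
theorem hasSum_sq_fc {n : ℕ} {g : (Fin n → ℝ) → ℂ} (hg : Continuous g) (hper : Per g) :
    HasSum (fun ξ => ‖fc g ξ‖ ^ 2) (∫ x, ‖g x‖ ^ 2 ∂(μT n)) := by
  obtain ⟨G, hG⟩ := exists_continuousMap_torus hg hper
  have h := UnitAddTorus.hasSum_sq_mFourierCoeff (ContinuousMap.toLp 2 volume ℂ G)
  simp only [UnitAddTorus.mFourierCoeff_toLp, ← fc_eq_mFourierCoeff hG] at h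
  convert h using 1
  simp only [← hG]
  rw [integral_toTorus fun t => ‖G t‖ ^ 2]
  refine integral_congr_ae ?_
  filter_upwards [ContinuousMap.coeFn_toLp (p := 2) (𝕜 := ℂ) volume G] with t ht
  rw [ht]

theorem hasSum_fc_mul_eChar {n : ℕ} {g : (Fin n → ℝ) → ℂ} (hg : Continuous g) (hper : Per g)
    (hs : Summable (fc g)) (x : Fin n → ℝ) :
    HasSum (fun ξ => fc g ξ * eChar x ξ) (g x) := by
  obtain ⟨G, hG⟩ := exists_continuousMap_torus hg hper
  have hc : fc g = UnitAddTorus.mFourierCoeff G := funext (fc_eq_mFourierCoeff hG)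
  have h := UnitAddTorus.hasSum_mFourier_series_apply_of_summable (hc ▸ hs) (toTorus x)
  simpa only [mFourier_toTorus, hG, ← hc, smul_eq_mul] using h

/-- Parseval's identity for an absolutely convergent trigonometric series. -/
theorem continuous_and_integral_sq_eChar_series {n : ℕ} {h : (Fin n → ℤ) → ℂ} (hs : Summable h) :
    Continuous (fun x => ∑' ξ, h ξ * eChar x ξ) ∧
      HasSum (fun ξ => ‖h ξ‖ ^ 2) (∫ x, ‖∑' ξ, h ξ * eChar x ξ‖ ^ 2 ∂(μT n)) := by
  have hsG : Summable fun ξ => h ξ • (UnitAddTorus.mFourier ξ : C(UnitAddTorus (Fin n), ℂ)) := by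
    refine .of_norm ?_
    simpa only [norm_smul, UnitAddTorus.mFourier_norm, mul_one] using hs.norm
  set G := ∑' ξ, h ξ • (UnitAddTorus.mFourier ξ : C(UnitAddTorus (Fin n), ℂ)) with hGdef
  have hG : ∀ x, G (toTorus x) = ∑' ξ, h ξ * eChar x ξ := by
    intro x
    have := (ContinuousMap.evalCLM ℂ (toTorus x)).hasSum hsG.hasSum
    rw [← hGdef] at this
    refine (HasSum.tsum_eq ?_).symm
    convert! this using 1
    ext ξ
    simp [mFourier_toTorus]
  have hcoef : ∀ ζ, UnitAddTorus.mFourierCoeff G ζ = h ζ := by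
    intro ζ
    rw [← UnitAddTorus.mFourierCoeff_toLp, ← UnitAddTorus.mFourierBasis_repr,
      HilbertBasis.repr_apply_apply]
    have h1 := (ContinuousMap.toLp (E := ℂ) 2 (volume : Measure (UnitAddTorus (Fin n))) ℂ).hasSum
      hsG.hasSum
    have h2 := (innerSL ℂ (UnitAddTorus.mFourierBasis ζ)).hasSum h1
    refine h2.unique ?_
    have := hasSum_ite_eq ζ (h ζ)
    convert! this using 1
    ext ξ
    have ho := orthonormal_iff_ite.1 (UnitAddTorus.orthonormal_mFourier (d := Fin n)) ζ ξ
    simp only [UnitAddTorus.coe_mFourierBasis, map_smul, innerSL_apply_apply,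
      smul_eq_mul]
    rw [ho]
    rcases eq_or_ne ξ ζ with rfl | hne
    · simp
    · simp [hne, hne.symm]
  have hcont : Continuous fun x => ∑' ξ, h ξ * eChar x ξ := by
    simp only [← hG]
    exact G.continuous.comp (isOpenQuotientMap_toTorus n).continuous
  refine ⟨hcont, ?_⟩
  have hb := UnitAddTorus.hasSum_sq_mFourierCoeff (ContinuousMap.toLp 2 volume ℂ G)
  simp only [UnitAddTorus.mFourierCoeff_toLp, hcoef] at hb
  convert hb using 1
  simp only [← hG]
  rw [integral_toTorus fun t => ‖G t‖ ^ 2]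
  refine integral_congr_ae ?_
  filter_upwards [ContinuousMap.coeFn_toLp (p := 2) (𝕜 := ℂ) volume G] with t ht
  rw [ht]

end TorusBridge

section Derivatives

open Set

variable {n : ℕ}

theorem contDiff_pd {g : (Fin n → ℝ) → ℂ} (hg : ContDiff ℝ (⊤ : ℕ∞) g) (j : Fin n) :
    ContDiff ℝ (⊤ : ℕ∞) (pd j g) :=
  (hg.fderiv_right (m := (⊤ : ℕ∞)) (by simp)).clm_apply contDiff_const

theorem Per.pd {g : (Fin n → ℝ) → ℂ} (hper : Per g) (j : Fin n) : Per (pd j g) := by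
  intro x v
  have h : (fun y => g (y + fun i => (v i : ℝ))) = g := funext fun y => hper y v
  simp only [_root_.pd]
  rw [← fderiv_comp_add_right, h]

theorem contDiff_iterate_pd {g : (Fin n → ℝ) → ℂ} (hg : ContDiff ℝ (⊤ : ℕ∞) g) (j : Fin n)
    (k : ℕ) : ContDiff ℝ (⊤ : ℕ∞) ((pd j)^[k] g) := by
  induction k with
  | zero => exact hg
  | succ k ih => rw [Function.iterate_succ_apply']; exact contDiff_pd ih j

theorem Per.iterate_pd {g : (Fin n → ℝ) → ℂ} (hper : Per g) (j : Fin n) (k : ℕ) :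
    Per ((_root_.pd j)^[k] g) := by
  induction k with
  | zero => exact hper
  | succ k ih => rw [Function.iterate_succ_apply']; exact ih.pd j

theorem mIdxList_single (j : Fin n) (k : ℕ) :
    mIdxList (Pi.single j k) = List.replicate k j := by
  have key : ∀ l : List (Fin n), l.Nodup →
      (l.flatMap fun i => List.replicate ((Pi.single j k : Fin n → ℕ) i) i) =
        if j ∈ l then List.replicate k j else [] := by
    intro l hl
    induction l with
    | nil => simp
    | cons i l ih =>
      rw [List.nodup_cons] at hl
      rw [List.flatMap_cons, ih hl.2]
      rcases eq_or_ne i j with rfl | hij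
      · simp [hl.1]
      · simp [hij, hij.symm]
  rw [mIdxList, key _ (List.nodup_finRange n)]
  simp

theorem pdM_single (j : Fin n) (k : ℕ) (g : (Fin n → ℝ) → ℂ) :
    pdM (Pi.single j k) g = (pd j)^[k] g := by
  rw [pdM, mIdxList_single]
  induction k with
  | zero => rfl
  | succ k ih => rw [List.replicate_succ, List.foldr_cons, ih, Function.iterate_succ_apply']

theorem integral_pd_eq_zero {g : (Fin n → ℝ) → ℂ} (hg : ContDiff ℝ (⊤ : ℕ∞) g) (hper : Per g)
    (j : Fin n) : ∫ x, pd j g x ∂(μT n) = 0 := by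
  obtain ⟨m, rfl⟩ : ∃ m, n = m + 1 := ⟨n - 1, by have := j.pos; omega⟩
  have hd : ∀ x, HasFDerivAt g (fderiv ℝ g x) x := fun x =>
    (hg.differentiable (by simp) x).hasFDerivAt
  have hsum : ∀ x, (∑ i, (Pi.single j (fderiv ℝ g x) :
      Fin (m + 1) → (Fin (m + 1) → ℝ) →L[ℝ] ℂ) i (Pi.single i 1)) = pd j g x := by
    intro x
    rw [Finset.sum_eq_single j]
    · simp [pd]
    · intro i _ hij
      simp [hij]
    · simp
  have key := integral_divergence_of_hasFDerivAt_off_countable' (0 : Fin (m + 1) → ℝ) 1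
    zero_le_one (fun i x => (Pi.single j (g x) : Fin (m + 1) → ℂ) i)
    (fun i x => (Pi.single j (fderiv ℝ g x) :
      Fin (m + 1) → (Fin (m + 1) → ℝ) →L[ℝ] ℂ) i) ∅ countable_empty ?_ ?_ ?_
  · simp only [hsum] at key
    rw [μT_eq_restrict_Icc, key]
    refine Finset.sum_eq_zero fun i _ => ?_
    rcases eq_or_ne i j with rfl | hij
    · rw [sub_eq_zero]
      refine integral_congr_ae (Filter.Eventually.of_forall fun x => ?_)
      have := hper (i.insertNth 0 x) (Pi.single i 1)
      simp only [Pi.single_eq_same, Pi.zero_apply, Pi.one_apply]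
      rw [← this]
      congr 1
      ext l
      refine Fin.succAboveCases i ?_ (fun l => ?_) l
      · simp
      · simp
    · simp [hij]
  · intro i
    rcases eq_or_ne i j with rfl | hij
    · simpa using hg.continuous.continuousOn
    · simpa [hij] using continuousOn_const
  · intro x _ i
    rcases eq_or_ne i j with rfl | hij
    · simpa using hd x
    · simpa [hij] using hasFDerivAt_const (0 : ℂ) x
  · simp only [hsum]
    exact (contDiff_pd hg j).continuous.continuousOn.integrableOn_compact isCompact_Icc

theorem contDiff_eChar (ξ : Fin n → ℤ) :
    ContDiff ℝ (⊤ : ℕ∞) (fun x : Fin n → ℝ => eChar x ξ) := by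
  unfold eChar
  have : ∀ j : Fin n, ContDiff ℝ (⊤ : ℕ∞) fun x : Fin n → ℝ => (x j : ℂ) := fun j =>
    Complex.ofRealCLM.contDiff.comp (contDiff_apply ℝ ℝ j)
  refine ContDiff.cexp (contDiff_const.mul (ContDiff.sum fun j _ => (this j).mul contDiff_const))

theorem per_eChar (ξ : Fin n → ℤ) : Per (fun x : Fin n → ℝ => eChar x ξ) := by
  intro x v
  simp only [← mFourier_toTorus]
  congr 1
  ext i
  simp [toTorus]

theorem pd_eChar (ξ : Fin n → ℤ) (j : Fin n) (x : Fin n → ℝ) :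
    pd j (fun x => eChar x ξ) x = 2 * π * Complex.I * ξ j * eChar x ξ := by
  have h1 : ∀ i, HasFDerivAt (fun x : Fin n → ℝ => (x i : ℂ))
      (Complex.ofRealCLM.comp (ContinuousLinearMap.proj (R := ℝ) (φ := fun _ : Fin n => ℝ) i)) x :=
    fun i => (Complex.ofRealCLM.comp
      (ContinuousLinearMap.proj (R := ℝ) (φ := fun _ : Fin n => ℝ) i)).hasFDerivAt
  have h2 := ((HasFDerivAt.fun_sum fun (i : Fin n) (_ : i ∈ Finset.univ) =>
    (h1 i).mul_const (ξ i : ℂ)).const_mul (2 * (π : ℂ) * Complex.I)).cexp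
  have hs : (∑ i, (ξ i : ℂ) • Complex.ofRealCLM.comp
      (ContinuousLinearMap.proj (R := ℝ) (φ := fun _ : Fin n => ℝ) i)) (Pi.single j 1) = ξ j := by
    rw [sum_apply, Finset.sum_eq_single j]
    · simp
    · intro i _ hij
      simp [hij]
    · simp
  rw [pd]
  unfold eChar
  rw [h2.fderiv]
  simp only [smul_apply, hs, smul_eq_mul]
  ring

theorem integrable_μT_of_continuous {E : Type*} [NormedAddCommGroup E] {g : (Fin n → ℝ) → E}
    (hg : Continuous g) : Integrable g (μT n) := by
  rw [μT_eq_restrict_Icc]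
  exact hg.continuousOn.integrableOn_compact isCompact_Icc

theorem fc_pd {g : (Fin n → ℝ) → ℂ} (hg : ContDiff ℝ (⊤ : ℕ∞) g) (hper : Per g)
    (j : Fin n) (η : Fin n → ℤ) : fc (pd j g) η = 2 * π * Complex.I * η j * fc g η := by
  have hprod : Per (fun x => eChar x (-η) * g x) := fun x v => by
    have h1 := per_eChar (-η) x v
    have h2 := hper x v
    simp only at h1 ⊢
    rw [h1, h2]
  have h0 := integral_pd_eq_zero ((contDiff_eChar (-η)).mul hg) hprod j
  have hpd : ∀ x, pd j (fun x => eChar x (-η) * g x) x =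
      eChar x (-η) * pd j g x - 2 * π * Complex.I * η j * (eChar x (-η) * g x) := by
    intro x
    have he := pd_eChar (-η) j x
    rw [pd] at he ⊢
    rw [fderiv_fun_mul ((contDiff_eChar (-η)).differentiable (by simp) x)
      (hg.differentiable (by simp) x)]
    simp only [add_apply, smul_apply, smul_eq_mul, he, pd]
    simp
    ring
  simp only [hpd] at h0
  have hc : Continuous fun x => eChar x (-η) := (contDiff_eChar (-η)).continuous
  have hi1 : Integrable (fun x => eChar x (-η) * pd j g x) (μT n) :=
    integrable_μT_of_continuous (hc.mul (contDiff_pd hg j).continuous)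
  have hi2 : Integrable (fun x => eChar x (-η) * g x) (μT n) :=
    integrable_μT_of_continuous (hc.mul hg.continuous)
  rw [integral_sub hi1 (hi2.const_mul _),
    integral_const_mul, sub_eq_zero] at h0
  rw [fc_eq_integral_eChar, fc_eq_integral_eChar, h0]

theorem fc_iterate_pd {g : (Fin n → ℝ) → ℂ} (hg : ContDiff ℝ (⊤ : ℕ∞) g) (hper : Per g)
    (j : Fin n) (k : ℕ) (η : Fin n → ℤ) :
    fc ((pd j)^[k] g) η = (2 * π * Complex.I * η j) ^ k * fc g η := by
  induction k with
  | zero => simp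
  | succ k ih =>
    rw [Function.iterate_succ_apply', fc_pd (contDiff_iterate_pd hg j k) (hper.iterate_pd j k),
      ih, pow_succ]
    ring

end Derivatives

section Weight

variable {n : ℕ}

/-- The Sobolev weight `1 + ∑ⱼ |2πηⱼ|²ᵏ` on the lattice `ℤⁿ`. -/
def sobolevWeight (k : ℕ) (η : Fin n → ℤ) : ℝ := 1 + ∑ j, (2 * π * |(η j : ℝ)|) ^ (2 * k)

theorem one_le_sobolevWeight (k : ℕ) (η : Fin n → ℤ) : 1 ≤ sobolevWeight k η := by
  have : 0 ≤ ∑ j, (2 * π * |(η j : ℝ)|) ^ (2 * k) := Finset.sum_nonneg fun j _ => by positivity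
  rw [sobolevWeight]
  linarith

theorem sobolevWeight_pos (k : ℕ) (η : Fin n → ℤ) : 0 < sobolevWeight k η :=
  zero_lt_one.trans_le (one_le_sobolevWeight k η)

/-- Weighted Bessel identity: derivatives control the weighted `ℓ²` norm of the coefficients. -/
theorem hasSum_sobolevWeight_mul_sq_fc {g : (Fin n → ℝ) → ℂ} (hg : ContDiff ℝ (⊤ : ℕ∞) g)
    (hper : Per g) (k : ℕ) :
    HasSum (fun η => sobolevWeight k η * ‖fc g η‖ ^ 2)
      ((∫ x, ‖g x‖ ^ 2 ∂(μT n)) + ∑ j, ∫ x, ‖(pd j)^[k] g x‖ ^ 2 ∂(μT n)) := by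
  have h := (hasSum_sq_fc hg.continuous hper).add (hasSum_sum fun j (_ : j ∈ Finset.univ) =>
    hasSum_sq_fc (contDiff_iterate_pd hg j k).continuous (hper.iterate_pd j k))
  convert h using 1
  ext η
  rw [sobolevWeight, add_mul, one_mul, Finset.sum_mul]
  congr 1
  refine Finset.sum_congr rfl fun j _ => ?_
  have hnorm : ‖2 * (π : ℂ) * Complex.I * η j‖ = 2 * π * |(η j : ℝ)| := by
    simp [abs_of_pos Real.pi_pos]
  rw [fc_iterate_pd hg hper, norm_mul, norm_pow, hnorm]
  ring

theorem summable_inv_sobolevWeight {k : ℕ} (hk : n < 2 * k) :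
    Summable fun η : Fin n → ℤ => (sobolevWeight k η)⁻¹ := by
  classical
  let b := Pi.basisFun ℝ (Fin n)
  let L := Submodule.span ℤ (Set.range b)
  have hL : ∀ η : Fin n → ℤ, castZ η ∈ L := by
    intro η
    have : castZ η = ∑ i, η i • b i := by
      ext j
      simp [castZ, b, Pi.single_apply]
    rw [this]
    exact Submodule.sum_mem _ fun i _ =>
      Submodule.smul_mem _ _ (Submodule.subset_span ⟨i, rfl⟩)
  let φ : (Fin n → ℤ) → L := fun η => ⟨castZ η, hL η⟩
  have hφ : Function.Injective φ := by
    intro η η' h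
    ext j
    have := congrFun (congrArg Subtype.val h) j
    simpa [φ, castZ] using this
  have hrank : Module.finrank ℤ L = n := by
    rw [ZLattice.rank ℝ L]
    simp
  have hs := (ZLattice.summable_norm_pow_inv L (2 * k) (by rw [hrank]; exact hk)).comp_injective hφ
  refine Summable.of_norm_bounded_eventually hs ?_
  have hfin : ({0} : Set (Fin n → ℤ)).Finite := Set.finite_singleton 0
  filter_upwards [hfin.compl_mem_cofinite] with η hη
  have hη0 : castZ η ≠ 0 := by
    intro h
    apply hη
    ext j
    have := congrFun h j
    simpa [castZ] using this
  have hpos : 0 < ‖castZ η‖ := norm_pos_iff.2 hη0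
  rw [Real.norm_of_nonneg (inv_nonneg.2 (sobolevWeight_pos k η).le)]
  simp only [Function.comp_apply, φ, inv_pow]
  refine inv_anti₀ (by positivity) ?_
  have : Nonempty (Fin n) := by
    by_contra hne
    rw [not_nonempty_iff] at hne
    exact hη0 (Subsingleton.elim _ _)
  obtain ⟨j, hmax⟩ := Finite.exists_max fun j => ‖castZ η j‖
  have hj : ‖castZ η‖ ≤ ‖castZ η j‖ := (pi_norm_le_iff_of_nonempty _).2 hmax
  rw [sobolevWeight]
  have h1 : (2 * π * |(η j : ℝ)|) ^ (2 * k) ≤ ∑ j, (2 * π * |(η j : ℝ)|) ^ (2 * k) :=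
    Finset.single_le_sum (f := fun j => (2 * π * |(η j : ℝ)|) ^ (2 * k))
      (fun i _ => by positivity) (Finset.mem_univ j)
  have h2 : ‖castZ η‖ ^ (2 * k) ≤ (2 * π * |(η j : ℝ)|) ^ (2 * k) := by
    refine pow_le_pow_left₀ (norm_nonneg _) (hj.trans ?_) _
    rw [castZ, Real.norm_eq_abs]
    have := Real.pi_gt_three
    nlinarith [abs_nonneg (η j : ℝ)]
  change ‖castZ η‖ ^ (2 * k) ≤ _
  linarith

end Weight

section Discrete

variable {ι : Type*}

theorem ENNReal.sq_tsum_mul_le (u v : ι → ℝ≥0∞) :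
    (∑' i, u i * v i) ^ 2 ≤ (∑' i, u i ^ 2) * ∑' i, v i ^ 2 := by
  let _ : MeasurableSpace ι := ⊤
  have h := ENNReal.lintegral_mul_le_Lp_mul_Lq (Measure.count : Measure ι)
    Real.HolderConjugate.two_two (f := u) (g := v)
    (measurable_from_top.aemeasurable) (measurable_from_top.aemeasurable)
  simp only [lintegral_count, Pi.mul_apply, ENNReal.rpow_two] at h
  calc (∑' i, u i * v i) ^ 2
      ≤ ((∑' i, u i ^ 2) ^ (1 / 2 : ℝ) * (∑' i, v i ^ 2) ^ (1 / 2 : ℝ)) ^ 2 := by gcongr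
    _ = _ := by
      rw [mul_pow, ← ENNReal.rpow_mul_natCast, ← ENNReal.rpow_mul_natCast]
      norm_num

theorem ENNReal.sq_tsum_le_tsum_inv_mul_tsum (w v : ι → ℝ≥0∞) (h0 : ∀ i, w i ≠ 0)
    (htop : ∀ i, w i ≠ ∞) :
    (∑' i, v i) ^ 2 ≤ (∑' i, (w i)⁻¹) * ∑' i, w i * v i ^ 2 := by
  have h := ENNReal.sq_tsum_mul_le (fun i => (w i)⁻¹ ^ (1 / 2 : ℝ))
    (fun i => w i ^ (1 / 2 : ℝ) * v i)
  have hsq : ∀ t : ℝ≥0∞, (t ^ (1 / 2 : ℝ)) ^ 2 = t := fun t => by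
    rw [← ENNReal.rpow_mul_natCast]
    norm_num
  have h1 : ∀ i, (w i)⁻¹ ^ (1 / 2 : ℝ) * (w i ^ (1 / 2 : ℝ) * v i) = v i := fun i => by
    rw [← mul_assoc, ← ENNReal.mul_rpow_of_nonneg _ _ (by norm_num),
      ENNReal.inv_mul_cancel (h0 i) (htop i), ENNReal.one_rpow, one_mul]
  simpa only [h1, mul_pow, hsq] using h

variable [AddCommGroup ι] {w : ι → ℝ≥0∞} {B : ι → ι → ℝ≥0∞} {M : ℝ≥0∞}

/-- `ℓ²` bound for a twisted convolution whose kernels are uniformly bounded in weighted `ℓ²`. -/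
theorem tsum_sq_twistedConv_le (h0 : ∀ i, w i ≠ 0) (htop : ∀ i, w i ≠ ∞)
    (hB : ∀ ξ, ∑' η, w η * B ξ η ^ 2 ≤ M) (F : ι → ℝ≥0∞) :
    ∑' ζ, (∑' ξ, F ξ * B ξ (ζ - ξ)) ^ 2 ≤ (∑' η, (w η)⁻¹) * M * ∑' ξ, F ξ ^ 2 := by
  calc ∑' ζ, (∑' ξ, F ξ * B ξ (ζ - ξ)) ^ 2
      ≤ ∑' ζ, (∑' η, (w η)⁻¹) * ∑' ξ, w (ζ - ξ) * (F ξ * B ξ (ζ - ξ)) ^ 2 := by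
        refine ENNReal.tsum_le_tsum fun ζ => ?_
        have h := ENNReal.sq_tsum_le_tsum_inv_mul_tsum (fun ξ => w (ζ - ξ))
          (fun ξ => F ξ * B ξ (ζ - ξ)) (fun _ => h0 _) (fun _ => htop _)
        have hS := (Equiv.subLeft ζ).tsum_eq fun η => (w η)⁻¹
        simp only [Equiv.subLeft_apply] at hS
        rwa [hS] at h
    _ = (∑' η, (w η)⁻¹) * ∑' ξ, F ξ ^ 2 * ∑' η, w η * B ξ η ^ 2 := by
        rw [ENNReal.tsum_mul_left, ENNReal.tsum_comm]
        congr 1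
        refine tsum_congr fun ξ => ?_
        rw [← ENNReal.tsum_mul_left, ← (Equiv.subRight ξ).tsum_eq fun η => F ξ ^ 2 * (w η * B ξ η ^ 2)]
        refine tsum_congr fun ζ => ?_
        simp only [Equiv.subRight_apply]
        ring
    _ ≤ (∑' η, (w η)⁻¹) * ∑' ξ, F ξ ^ 2 * M := by
        gcongr with ξ
        exact hB ξ
    _ = _ := by
        rw [ENNReal.tsum_mul_right]
        ring

theorem tsum_tsum_twistedConv_ne_top (h0 : ∀ i, w i ≠ 0) (htop : ∀ i, w i ≠ ∞)
    (hS : ∑' η, (w η)⁻¹ ≠ ∞) (hM : M ≠ ∞) (hB : ∀ ξ, ∑' η, w η * B ξ η ^ 2 ≤ M)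
    {F : ι → ℝ≥0∞} (hF : ∑' ξ, F ξ ≠ ∞) :
    ∑' ξ, ∑' ζ, F ξ * B ξ (ζ - ξ) ≠ ∞ := by
  have hl : ∀ ξ, ∑' η, B ξ η ≤ ((∑' η, (w η)⁻¹) * M) ^ (1 / 2 : ℝ) := fun ξ => by
    have h := (ENNReal.sq_tsum_le_tsum_inv_mul_tsum w (B ξ) h0 htop).trans
      (mul_le_mul_right (hB ξ) _)
    rw [← ENNReal.rpow_two] at h
    rw [one_div]
    exact (ENNReal.le_rpow_inv_iff (by norm_num)).2 h
  refine ne_top_of_le_ne_top (ENNReal.mul_ne_top hF (ENNReal.rpow_ne_top_of_nonneg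
    (y := (1 / 2 : ℝ)) (by norm_num) (ENNReal.mul_ne_top hS hM))) ?_
  rw [← ENNReal.tsum_mul_right]
  refine ENNReal.tsum_le_tsum fun ξ => ?_
  rw [ENNReal.tsum_mul_left]
  have hr := (Equiv.subRight ξ).tsum_eq (B ξ)
  simp only [Equiv.subRight_apply] at hr
  rw [hr]
  gcongr
  exact hl ξ

end Discrete

theorem HasSum.tsum_ofReal {ι : Type*} {f : ι → ℝ} {s : ℝ} (h : HasSum f s) (h0 : ∀ i, 0 ≤ f i) :
    ∑' i, ENNReal.ofReal (f i) = ENNReal.ofReal s := by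
  rw [← h.tsum_eq, ENNReal.ofReal_tsum_of_nonneg h0 h.summable]

theorem HasSum.tsum_enorm_sq {ι : Type*} {f : ι → ℂ} {s : ℝ}
    (h : HasSum (fun i => ‖f i‖ ^ 2) s) : ∑' i, ‖f i‖ₑ ^ 2 = ENNReal.ofReal s := by
  rw [← h.tsum_ofReal fun i => by positivity]
  refine tsum_congr fun i => ?_
  rw [ENNReal.ofReal_pow (norm_nonneg _), ofReal_norm]

section Boundedness

variable {n : ℕ}

theorem tsum_sobolevWeight_mul_enorm_sq_fc {g : (Fin n → ℝ) → ℂ}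
    (hg : ContDiff ℝ (⊤ : ℕ∞) g) (hper : Per g) (k : ℕ) :
    ∑' η, ENNReal.ofReal (sobolevWeight k η) * ‖fc g η‖ₑ ^ 2 =
      ENNReal.ofReal
        ((∫ x, ‖g x‖ ^ 2 ∂(μT n)) + ∑ j, ∫ x, ‖(pd j)^[k] g x‖ ^ 2 ∂(μT n)) := by
  rw [← (hasSum_sobolevWeight_mul_sq_fc hg hper k).tsum_ofReal
    fun η => mul_nonneg (sobolevWeight_pos k η).le (sq_nonneg _)]
  refine tsum_congr fun η => ?_
  rw [ENNReal.ofReal_mul (sobolevWeight_pos k η).le, ENNReal.ofReal_pow (norm_nonneg _),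
    ofReal_norm]

theorem tsum_inv_ofReal_sobolevWeight_ne_top {k : ℕ} (hk : n < 2 * k) :
    ∑' η : Fin n → ℤ, (ENNReal.ofReal (sobolevWeight k η))⁻¹ ≠ ∞ := by
  simp only [← ENNReal.ofReal_inv_of_pos (sobolevWeight_pos k _)]
  exact (summable_inv_sobolevWeight hk).tsum_ofReal_ne_top

theorem tsum_enorm_fc_ne_top {g : (Fin n → ℝ) → ℂ}
    (hg : ContDiff ℝ (⊤ : ℕ∞) g) (hper : Per g) : ∑' η, ‖fc g η‖ₑ ≠ ∞ := by
  have hk : n < 2 * (n + 1) := by omega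
  have h := ENNReal.sq_tsum_le_tsum_inv_mul_tsum
    (fun η => ENNReal.ofReal (sobolevWeight (n + 1) η)) (fun η => ‖fc g η‖ₑ)
    (fun η => (ENNReal.ofReal_pos.2 (sobolevWeight_pos _ η)).ne') fun _ => ENNReal.ofReal_ne_top
  rw [tsum_sobolevWeight_mul_enorm_sq_fc hg hper] at h
  intro htop
  rw [htop] at h
  exact ne_top_of_le_ne_top (ENNReal.mul_ne_top (tsum_inv_ofReal_sobolevWeight_ne_top hk)
    ENNReal.ofReal_ne_top) h (by simp)

theorem integral_norm_sq_le {g : (Fin n → ℝ) → ℂ} (hg : Continuous g) {C : ℝ}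
    (hC : ∀ x, ‖g x‖ ≤ C) : ∫ x, ‖g x‖ ^ 2 ∂(μT n) ≤ C ^ 2 := by
  have h := integral_mono (integrable_μT_of_continuous (hg.norm.pow 2))
    (integrable_const (μ := μT n) (C ^ 2)) fun x => pow_le_pow_left₀ (norm_nonneg _) (hC x) 2
  simpa using h

/-- Boundedness on `L²` of a periodic pseudo-differential operator whose symbol has `k > n/2`
derivatives in `x` bounded uniformly in the frequency. -/
theorem exists_continuous_op_and_integral_sq_le {a : (Fin n → ℝ) → (Fin n → ℤ) → ℂ}
    (ha_smooth : ∀ ξ, ContDiff ℝ (⊤ : ℕ∞) fun x => a x ξ) (ha_per : ∀ ξ, Per fun x => a x ξ)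
    {k : ℕ} (hk : n < 2 * k) {K : ℝ} (ha_zero : ∀ x ξ, ‖a x ξ‖ ≤ K)
    (ha_pd : ∀ j x ξ, ‖(pd j)^[k] (fun x' => a x' ξ) x‖ ≤ K) :
    ∃ C : ℝ, 0 ≤ C ∧ ∀ f : (Fin n → ℝ) → ℂ, ContDiff ℝ (⊤ : ℕ∞) f → Per f →
      Continuous (Op a f) ∧ ∫ x, ‖Op a f x‖ ^ 2 ∂(μT n) ≤ C * ∫ x, ‖f x‖ ^ 2 ∂(μT n) := by
  set w : (Fin n → ℤ) → ℝ≥0∞ := fun η => ENNReal.ofReal (sobolevWeight k η)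
  set b : (Fin n → ℤ) → (Fin n → ℤ) → ℂ := fun ξ => fc fun x => a x ξ
  set M : ℝ≥0∞ := ENNReal.ofReal (K ^ 2 + ∑ _j : Fin n, K ^ 2)
  have h0 : ∀ η, w η ≠ 0 := fun η => (ENNReal.ofReal_pos.2 (sobolevWeight_pos _ η)).ne'
  have htop : ∀ η, w η ≠ ∞ := fun _ => ENNReal.ofReal_ne_top
  have hS : ∑' η, (w η)⁻¹ ≠ ∞ := tsum_inv_ofReal_sobolevWeight_ne_top hk
  have hM : M ≠ ∞ := ENNReal.ofReal_ne_top
  have hb : ∀ ξ, ∑' η, w η * ‖b ξ η‖ₑ ^ 2 ≤ M := fun ξ => by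
    rw [tsum_sobolevWeight_mul_enorm_sq_fc (ha_smooth ξ) (ha_per ξ)]
    refine ENNReal.ofReal_le_ofReal (add_le_add ?_ (Finset.sum_le_sum fun j _ => ?_))
    · exact integral_norm_sq_le (ha_smooth ξ).continuous fun x => ha_zero x ξ
    · exact integral_norm_sq_le (contDiff_iterate_pd (ha_smooth ξ) j k).continuous
        fun x => ha_pd j x ξ
  refine ⟨((∑' η, (w η)⁻¹) * M).toReal, ENNReal.toReal_nonneg, fun f hf hfper => ?_⟩
  set F := fc f
  set h : (Fin n → ℤ) → ℂ := fun ζ => ∑' ξ, F ξ * b ξ (ζ - ξ)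
  have hdouble : ∑' ξ, ∑' ζ, ‖F ξ‖ₑ * ‖b ξ (ζ - ξ)‖ₑ ≠ ∞ :=
    tsum_tsum_twistedConv_ne_top (B := fun ξ η => ‖b ξ η‖ₑ) h0 htop hS hM hb
      (tsum_enorm_fc_ne_top hf hfper)
  have hle : ∀ ζ, ‖h ζ‖ₑ ≤ ∑' ξ, ‖F ξ‖ₑ * ‖b ξ (ζ - ξ)‖ₑ := fun ζ => by
    refine enorm_tsum_le_tsum_enorm.trans_eq (tsum_congr fun ξ => ?_)
    rw [enorm_mul]
  have hsum : Summable h := by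
    refine .of_enorm (ne_top_of_le_ne_top hdouble ?_)
    rw [ENNReal.tsum_comm]
    exact ENNReal.tsum_le_tsum hle
  have hop : Op a f = fun x => ∑' ζ, h ζ * eChar x ζ := by
    funext x
    have hexp : ∀ ξ, eChar x ξ * a x ξ * fc f ξ =
        ∑' ζ, F ξ * b ξ (ζ - ξ) * eChar x ζ := by
      intro ξ
      have hs := (hasSum_fc_mul_eChar (ha_smooth ξ).continuous (ha_per ξ)
        (.of_enorm (tsum_enorm_fc_ne_top (ha_smooth ξ) (ha_per ξ))) x).mul_left
          (eChar x ξ * F ξ)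
      rw [← (Equiv.subRight ξ).hasSum_iff] at hs
      rw [show eChar x ξ * a x ξ * fc f ξ = eChar x ξ * F ξ * a x ξ by ring, ← hs.tsum_eq]
      refine tsum_congr fun ζ => ?_
      have he : eChar x ζ = eChar x ξ * eChar x (ζ - ξ) := by rw [← eChar_add, add_sub_cancel]
      rw [he]
      simp only [Function.comp_apply, Equiv.subRight_apply]
      ring
    have hprod : Summable fun p : (Fin n → ℤ) × (Fin n → ℤ) =>
        F p.1 * b p.1 (p.2 - p.1) * eChar x p.2 := by
      refine .of_enorm ?_
      rw [ENNReal.tsum_prod (f := fun ξ ζ => ‖F ξ * b ξ (ζ - ξ) * eChar x ζ‖ₑ)]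
      have he : ∀ ζ, ‖eChar x ζ‖ₑ = 1 := fun ζ => by
        rw [← ofReal_norm, norm_eChar, ENNReal.ofReal_one]
      simpa only [enorm_mul, he, mul_one] using hdouble
    calc Op a f x = ∑' ξ, ∑' ζ, F ξ * b ξ (ζ - ξ) * eChar x ζ := tsum_congr hexp
      _ = ∑' ζ, ∑' ξ, F ξ * b ξ (ζ - ξ) * eChar x ζ :=
        (Summable.tsum_comm (f := fun ξ ζ => F ξ * b ξ (ζ - ξ) * eChar x ζ) hprod).symm
      _ = ∑' ζ, h ζ * eChar x ζ := tsum_congr fun ζ =>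
        tsum_mul_right (f := fun ξ => F ξ * b ξ (ζ - ξ)) (a := eChar x ζ)
  obtain ⟨hcont, hpars⟩ := continuous_and_integral_sq_eChar_series hsum
  rw [hop]
  refine ⟨hcont, ?_⟩
  have hmain : ENNReal.ofReal (∫ x, ‖∑' ζ, h ζ * eChar x ζ‖ ^ 2 ∂(μT n)) ≤
      (∑' η, (w η)⁻¹) * M * ENNReal.ofReal (∫ x, ‖f x‖ ^ 2 ∂(μT n)) := by
    have hF : ∑' ξ, ‖F ξ‖ₑ ^ 2 = ENNReal.ofReal (∫ x, ‖f x‖ ^ 2 ∂(μT n)) :=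
      (hasSum_sq_fc hf.continuous hfper).tsum_enorm_sq
    rw [← hpars.tsum_enorm_sq, ← hF]
    refine le_trans (ENNReal.tsum_le_tsum fun ζ => ?_)
      (tsum_sq_twistedConv_le (B := fun ξ η => ‖b ξ η‖ₑ) h0 htop hb fun ξ => ‖F ξ‖ₑ)
    gcongr
    exact hle ζ
  have hf0 : 0 ≤ ∫ x, ‖f x‖ ^ 2 ∂(μT n) := integral_nonneg fun x => by positivity
  rw [← ENNReal.ofReal_toReal (ENNReal.mul_ne_top hS hM),
    ← ENNReal.ofReal_mul ENNReal.toReal_nonneg] at hmain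
  exact (ENNReal.ofReal_le_ofReal_iff (mul_nonneg ENNReal.toReal_nonneg hf0)).1 hmain

theorem lpT_eq_toReal_eLpNorm {g : (Fin n → ℝ) → ℂ} (hg : Continuous g) {p : ℝ} (hp : 0 < p) :
    MemLp g (ENNReal.ofReal p) (μT n) ∧
      lpT n p g = (eLpNorm g (ENNReal.ofReal p) (μT n)).toReal := by
  have hp0 : ENNReal.ofReal p ≠ 0 := (ENNReal.ofReal_pos.2 hp).ne'
  have hm : MemLp g (ENNReal.ofReal p) (μT n) := by
    rw [← integrable_norm_rpow_iff hg.aestronglyMeasurable hp0 ENNReal.ofReal_ne_top,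
      ENNReal.toReal_ofReal hp.le]
    exact integrable_μT_of_continuous (hg.norm.rpow_const fun _ => Or.inr hp.le)
  refine ⟨hm, ?_⟩
  rw [hm.eLpNorm_eq_integral_rpow_norm hp0 ENNReal.ofReal_ne_top, ENNReal.toReal_ofReal hp.le,
    ENNReal.toReal_ofReal (by positivity), lpT, one_div]

/-- Monotonicity of the `L^p(𝕋ⁿ)` norms in the exponent. -/
theorem lpT_mono {g : (Fin n → ℝ) → ℂ} (hg : Continuous g) {s t : ℝ} (hs : 0 < s) (hst : s ≤ t) :
    lpT n s g ≤ lpT n t g := by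
  obtain ⟨-, hs'⟩ := lpT_eq_toReal_eLpNorm hg hs
  obtain ⟨hm, ht'⟩ := lpT_eq_toReal_eLpNorm hg (hs.trans_le hst)
  rw [hs', ht']
  exact ENNReal.toReal_mono hm.eLpNorm_ne_top (eLpNorm_le_eLpNorm_of_exponent_le
    (ENNReal.ofReal_le_ofReal hst) hg.aestronglyMeasurable)

theorem lpT_two (g : (Fin n → ℝ) → ℂ) : lpT n 2 g = √(∫ x, ‖g x‖ ^ 2 ∂(μT n)) := by
  simp only [lpT, Real.rpow_two, Real.sqrt_eq_rpow]

end Boundedness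

/-- If a symbol `a : 𝕋ⁿ × ℤⁿ → ℂ` satisfies `|∂_x^β a(x,ξ)| ≤ C_k` for `|β| ≤ [n/2]+1`,
then `a(x,D) : L^p(𝕋ⁿ) → L^q(𝕋ⁿ)` is bounded, where `2 ≤ p < ∞` and `1/p + 1/q = 1`. -/
theorem periodic_pseudodiff_Lp_to_Lq_bounded
    (n : ℕ) (hn : 1 ≤ n) (p q : ℝ) (hp2 : 2 ≤ p) (hpq : 1 / p + 1 / q = 1)
    (a : (Fin n → ℝ) → (Fin n → ℤ) → ℂ)
    (ha_smooth : ∀ ξ, ContDiff ℝ (⊤ : ℕ∞) fun x => a x ξ)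
    (ha_per : ∀ ξ, Per fun x => a x ξ)
    (Ck : ℝ) (hCk : 0 < Ck)
    (ha : ∀ β : Fin n → ℕ, (∑ j, β j) ≤ n / 2 + 1 →
      ∀ (x : Fin n → ℝ) (ξ : Fin n → ℤ), ‖pdM β (fun x' => a x' ξ) x‖ ≤ Ck) :
    ∃ C : ℝ, 0 < C ∧ ∀ f : (Fin n → ℝ) → ℂ, ContDiff ℝ (⊤ : ℕ∞) f → Per f →
      lpT n q (Op a f) ≤ C * lpT n p f := by
  have hk : n < 2 * (n / 2 + 1) := by omega
  obtain ⟨C, hC, h⟩ := exists_continuous_op_and_integral_sq_le ha_smooth ha_per hk (K := Ck)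
    (fun x ξ => by
      have h0 : mIdxList (0 : Fin n → ℕ) = [] := by simp [mIdxList]
      simpa [pdM, h0] using ha 0 (by simp) x ξ)
    (fun j x ξ => by
      have := ha (Pi.single j (n / 2 + 1)) (by simp) x ξ
      rwa [pdM_single] at this)
  have hp0 : 0 < p := by linarith
  have hp1 : 1 / p ≤ 1 / 2 := one_div_le_one_div_of_le two_pos hp2
  have hp1' : 0 < 1 / p := one_div_pos.2 hp0
  have hq0 : 0 < q := one_div_pos.1 (by linarith)
  have hq2 : q ≤ 2 := le_of_one_div_le_one_div two_pos (by linarith)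
  refine ⟨√C + 1, by positivity, fun f hf hfper => ?_⟩
  obtain ⟨hcont, hle⟩ := h f hf hfper
  calc lpT n q (Op a f) ≤ lpT n 2 (Op a f) := lpT_mono hcont hq0 hq2
    _ ≤ √C * lpT n 2 f := by
      rw [lpT_two, lpT_two, ← Real.sqrt_mul hC]
      exact Real.sqrt_le_sqrt hle
    _ ≤ (√C + 1) * lpT n 2 f := by
      gcongr
      · rw [lpT_two]
        positivity
      · linarith
    _ ≤ (√C + 1) * lpT n p f := by
      gcongr
      exact lpT_mono hf.continuous two_pos hp2
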